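/- arXiv:0711.4179 — 2 statements merged into one kernel-verified Lean document; each statement's English description precedes it below -/
import Mathlib

section
/- There exists an absolute constant c > 0 with the following property. Let n ≥ 2, η > 0, B ≥ 1, and Q a positive integer. Let A(k), k ≥ 0, be a sequence of n×n doubly stochastic matrices with positive diagonal entries whose positive entries are all at least η, and such that for every k the directed graph with edge set E(A(kB)) ∪ ⋯ ∪ E(A((k+1)B−1)) is strongly connected. Let x(0) ∈ ℝⁿ have all components equal to multiples of 1/Q with U = max_i x_i(0) > L = min_i x_i(0), and let the sequence evolve by the quantized update x_i(k+1) = ⌊Σ_{j=1}^n a_{ij}(k) x_j(k)⌋_{1/Q}. Then there exist a time T and a value x_f such that x_i(k) = x_f for all i and all k ≥ T, and |x_f − (1/n) Σ_{i=1}^n x_i(0)| ≤ (c/Q)(n²/η) B log(Q n (U − L)). -/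
open Matrix Finset Real Filter

/-- A matrix is doubly stochastic if entrywise nonnegative with all rows and columns summing to 1. -/
def IsDoublyStochastic {n : ℕ} (A : Matrix (Fin n) (Fin n) ℝ) : Prop :=
  (∀ i j, 0 ≤ A i j) ∧ (∀ i, ∑ j, A i j = 1) ∧ (∀ j, ∑ i, A i j = 1)

/-- The average of the components of a vector. -/
noncomputable def avgVec {n : ℕ} (x : Fin n → ℝ) : ℝ := (∑ i, x i) / n

/-- The sample variance V(x) = Σ_i (x_i - x̄)². -/
noncomputable def sampleVar {n : ℕ} (x : Fin n → ℝ) : ℝ := ∑ i, (x i - avgVec x) ^ 2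

/-- The Lyapunov function V̲(x) = Σ_i (x_i - min_j x_j)². -/
noncomputable def underVar {n : ℕ} (x : Fin n → ℝ) : ℝ := ∑ i, (x i - ⨅ j, x j) ^ 2

/-- Σ_{i=1}^{n-1} (x_i - x_{i+1})² for a vector indexed by `Fin n`. -/
noncomputable def sumSqDiff {n : ℕ} (x : Fin n → ℝ) : ℝ :=
  ∑ i : Fin n, if h : (i : ℕ) + 1 < n then (x i - x ⟨(i : ℕ) + 1, h⟩) ^ 2 else 0

/-- Rounding down to the nearest multiple of 1/Q. -/
noncomputable def qfloor (Q : ℕ) (y : ℝ) : ℝ := (⌊(Q : ℝ) * y⌋ : ℝ) / Q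

/-- Doubly stochastic with positive diagonal and all positive entries at least η. -/
def GoodWeights {n : ℕ} (η : ℝ) (A : Matrix (Fin n) (Fin n) ℝ) : Prop :=
  IsDoublyStochastic A ∧ (∀ i, 0 < A i i) ∧ ∀ i j, 0 < A i j → η ≤ A i j

/-- The directed graph with edges `E(A(kB)) ∪ ⋯ ∪ E(A((k+1)B-1))` is strongly connected;
here `(j,i) ∈ E(A)` iff `A i j > 0`. -/
def BlockConnected {n : ℕ} (A : ℕ → Matrix (Fin n) (Fin n) ℝ) (B k : ℕ) : Prop :=
  ∀ u v : Fin n,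
    Relation.ReflTransGen (fun a b => ∃ t, k * B ≤ t ∧ t < (k + 1) * B ∧ 0 < A t b a) u v

/-- Assumption 3 of the paper for the (already sorted) vector `y = x(kB)`: for every cut `d`,
either the d-th and (d+1)-th components are equal, or some edge crosses the cut during
the time block `[kB, (k+1)B)`. -/
def CutCondition {n : ℕ} (A : ℕ → Matrix (Fin n) (Fin n) ℝ) (B k : ℕ) (y : Fin n → ℝ) : Prop :=
  ∀ d : Fin n, ∀ h : (d : ℕ) + 1 < n,
    y d = y ⟨(d : ℕ) + 1, h⟩ ∨
      ∃ t, k * B ≤ t ∧ t < (k + 1) * B ∧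
        ∃ i j : Fin n, i ≤ d ∧ d < j ∧ (0 < A t i j ∨ 0 < A t j i)

/-- Assumption 3 of the paper at time block `k`: after reordering the components of `x`
in nonincreasing order via a permutation `σ`, for every cut `d`, either the d-th and
(d+1)-th ordered components are equal, or some edge crossing the cut appears during the
time block `[kB, (k+1)B)`. -/
def CutConditionPerm {n : ℕ} (A : ℕ → Matrix (Fin n) (Fin n) ℝ) (B k : ℕ)
    (x : Fin n → ℝ) : Prop :=
  ∃ σ : Equiv.Perm (Fin n), Antitone (x ∘ σ) ∧
    ∀ d : Fin n, ∀ h : (d : ℕ) + 1 < n,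
      x (σ d) = x (σ ⟨(d : ℕ) + 1, h⟩) ∨
        ∃ t, k * B ≤ t ∧ t < (k + 1) * B ∧
          ∃ i j : Fin n, i ≤ d ∧ d < j ∧ (0 < A t (σ i) (σ j) ∨ 0 < A t (σ j) (σ i))


lemma row_id {n : ℕ} (a u : Fin n → ℝ) (ha : ∑ j, a j = 1) :
    (∑ j, a j * u j) ^ 2 = ∑ j, a j * u j ^ 2
      - 1 / 2 * ∑ i, ∑ j, a i * a j * (u i - u j) ^ 2 := by
  have h : ∑ i, ∑ j, a i * a j * (u i - u j) ^ 2
      = ∑ i, ∑ j, ((a i * u i ^ 2) * a j + a i * (a j * u j ^ 2)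
        - 2 * ((a i * u i) * (a j * u j))) := by
    refine Finset.sum_congr rfl fun i _ => Finset.sum_congr rfl fun j _ => by ring
  rw [h]
  simp only [Finset.sum_add_distrib, Finset.sum_sub_distrib, ← Finset.mul_sum, ← Finset.sum_mul, ha]
  ring

lemma step_decrease {n : ℕ} {η : ℝ} (hη : 0 < η) (A : Matrix (Fin n) (Fin n) ℝ)
    (hA : GoodWeights η A)
    (u : Fin n → ℝ) (r : Fin n → ℕ) (D : Finset ℕ) (g : ℕ → ℝ)
    (hcross : ∀ d ∈ D, ∃ i j, 0 < A i j ∧ ((r i ≤ d ∧ d < r j) ∨ (r j ≤ d ∧ d < r i)))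
    (hsq : ∀ i j, ∑ d ∈ D with (r i ≤ d ∧ d < r j), g d ^ 2 ≤ (u i - u j) ^ 2) :
    ∑ i, (∑ j, A i j * u j) ^ 2 ≤ ∑ i, u i ^ 2 - η / 2 * ∑ d ∈ D, g d ^ 2 := by
  obtain ⟨⟨hnn, hrow, hcol⟩, hdiag, hmin⟩ := hA
  have h1 : ∑ i, (∑ j, A i j * u j) ^ 2 = ∑ i, u i ^ 2
      - 1 / 2 * ∑ k, ∑ i, ∑ j, A k i * A k j * (u i - u j) ^ 2 := by
    simp_rw [fun k => row_id (A k) u (hrow k)]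
    rw [Finset.sum_sub_distrib, ← Finset.mul_sum, Finset.sum_comm]
    simp_rw [← Finset.sum_mul, hcol, one_mul]
  rw [h1]
  set f : Fin n → Fin n → ℝ := fun i j => ∑ d ∈ D with (r i ≤ d ∧ d < r j), g d ^ 2 with hf
  have hff : ∀ i j, f i j + f j i ≤ (u i - u j) ^ 2 := by
    intro i j
    have h0 : f i j = 0 ∨ f j i = 0 := by
      rcases le_total (r i) (r j) with h | h
      · right
        apply Finset.sum_eq_zero
        intro d hd
        simp only [Finset.mem_filter] at hd
        omega
      · left
        apply Finset.sum_eq_zero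
        intro d hd
        simp only [Finset.mem_filter] at hd
        omega
    rcases h0 with h | h
    · rw [h, zero_add, ← neg_sub, neg_sq]; exact hsq j i
    · rw [h, add_zero]; exact hsq i j
  -- per-row bound
  have h2 : ∀ k, ∑ d ∈ D, g d ^ 2 * ((∑ i with r i ≤ d, A k i) * (∑ j with d < r j, A k j))
      ≤ 1 / 2 * ∑ i, ∑ j, A k i * A k j * (u i - u j) ^ 2 := by
    intro k
    have e1 : ∑ d ∈ D, g d ^ 2 * ((∑ i with r i ≤ d, A k i) * (∑ j with d < r j, A k j))
        = ∑ i, ∑ j, A k i * A k j * f i j := by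
      have e0 : ∀ d, g d ^ 2 * ((∑ i with r i ≤ d, A k i) * (∑ j with d < r j, A k j))
          = ∑ i, ∑ j, A k i * A k j * (if r i ≤ d ∧ d < r j then g d ^ 2 else 0) := by
        intro d
        rw [Finset.sum_filter, Finset.sum_filter, Finset.sum_mul_sum, Finset.mul_sum]
        refine Finset.sum_congr rfl fun i _ => ?_
        rw [Finset.mul_sum]
        refine Finset.sum_congr rfl fun j _ => ?_
        split_ifs <;> first | (exfalso; omega) | ring
      simp only [e0]
      rw [Finset.sum_comm]
      refine Finset.sum_congr rfl fun i _ => ?_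
      rw [Finset.sum_comm]
      refine Finset.sum_congr rfl fun j _ => ?_
      simp only [hf]
      rw [Finset.sum_filter, Finset.mul_sum]
    have e2 : ∑ i, ∑ j, A k i * A k j * f i j = ∑ i, ∑ j, A k i * A k j * f j i := by
      rw [Finset.sum_comm]
      refine Finset.sum_congr rfl fun i _ => Finset.sum_congr rfl fun j _ => by ring
    have e3 : ∑ i, ∑ j, A k i * A k j * f i j + ∑ i, ∑ j, A k i * A k j * f j i
        ≤ ∑ i, ∑ j, A k i * A k j * (u i - u j) ^ 2 := by
      simp only [← Finset.sum_add_distrib]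
      refine Finset.sum_le_sum fun i _ => Finset.sum_le_sum fun j _ => ?_
      rw [← mul_add]
      exact mul_le_mul_of_nonneg_left (hff i j) (mul_nonneg (hnn _ _) (hnn _ _))
    rw [e1]; linarith
  have h3 : ∀ d ∈ D, η / 2 ≤
      ∑ k, ((∑ i with r i ≤ d, A k i) * (∑ j with d < r j, A k j)) := by
    intro d hd
    obtain ⟨i, j, hij, hc⟩ := hcross d hd
    have hpos : ∀ (k : Fin n) (p : Fin n → Prop) [DecidablePred p], 0 ≤ ∑ i with p i, A k i :=
      fun k p _ => Finset.sum_nonneg fun i _ => hnn _ _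
    refine le_trans ?_ (Finset.single_le_sum (f := fun k => (∑ i with r i ≤ d, A k i) * (∑ j with d < r j, A k j)) (fun k _ => mul_nonneg (hpos k _) (hpos k _)) (Finset.mem_univ i))
    have hs : (∑ l with r l ≤ d, A i l) + (∑ l with d < r l, A i l) = 1 := by
      rw [← hrow i, ← Finset.sum_filter_add_sum_filter_not Finset.univ (fun l => r l ≤ d)]
      simp only [not_le]
    have hge : ∀ (p : Fin n → Prop) [DecidablePred p] (l : Fin n), p l → 0 < A i l →
        η ≤ ∑ i' with p i', A i i' := by
      intro p _ l hl hp
      exact (hmin _ _ hp).trans (Finset.single_le_sum (f := fun l => A i l) (fun _ _ => hnn _ _) (by simp [hl]))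
    have hb : η ≤ (∑ l with r l ≤ d, A i l) ∧ η ≤ (∑ l with d < r l, A i l) := by
      rcases hc with ⟨h, h'⟩ | ⟨h, h'⟩
      · exact ⟨hge _ i h (hdiag i), hge _ j h' hij⟩
      · exact ⟨hge _ j h hij, hge _ i h' (hdiag i)⟩
    obtain ⟨b1, b2⟩ := hb
    generalize (∑ l with r l ≤ d, A i l) = p at *
    generalize (∑ l with d < r l, A i l) = q at *
    nlinarith [mul_nonneg (sub_nonneg.2 b1) (sub_nonneg.2 b2)]
  have h4 : η / 2 * ∑ d ∈ D, g d ^ 2 ≤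
      ∑ k, ∑ d ∈ D, g d ^ 2 * ((∑ i with r i ≤ d, A k i) * (∑ j with d < r j, A k j)) := by
    rw [Finset.sum_comm, Finset.mul_sum]
    refine Finset.sum_le_sum fun d hd => ?_
    rw [← Finset.mul_sum, mul_comm]
    exact mul_le_mul_of_nonneg_left (h3 d hd) (sq_nonneg _)
  have h5 := h4.trans (Finset.sum_le_sum fun k _ => h2 k)
  rw [← Finset.mul_sum] at h5
  linarith

lemma avg_le {n : ℕ} (a z : Fin n → ℝ) (c : ℝ) (hnn : ∀ j, 0 ≤ a j) (ha : ∑ j, a j = 1)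
    (h : ∀ j, 0 < a j → z j ≤ c) : ∑ j, a j * z j ≤ c := by
  calc ∑ j, a j * z j ≤ ∑ j, a j * c := by
        refine Finset.sum_le_sum fun j _ => ?_
        rcases (hnn j).eq_or_lt with h0 | h0
        · simp [← h0]
        · exact mul_le_mul_of_nonneg_left (h j h0) h0.le
    _ = c := by rw [← Finset.sum_mul, ha, one_mul]

lemma le_avg {n : ℕ} (a z : Fin n → ℝ) (c : ℝ) (hnn : ∀ j, 0 ≤ a j) (ha : ∑ j, a j = 1)
    (h : ∀ j, 0 < a j → c ≤ z j) : c ≤ ∑ j, a j * z j := by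
  have := avg_le a (fun j => - z j) (-c) hnn ha (fun j hj => neg_le_neg (h j hj))
  simp only [mul_neg, Finset.sum_neg_distrib] at this
  linarith

lemma block_decrease {n : ℕ} (hn : 0 < n) {η : ℝ} (hη : 0 < η)
    (A : ℕ → Matrix (Fin n) (Fin n) ℝ)
    (hA : ∀ k, GoodWeights η (A k)) (B : ℕ) (Z : ℕ → Fin n → ℤ)
    (hZ : ∀ k i, Z (k + 1) i = ⌊∑ j, A k i j * (Z k j : ℝ)⌋)
    (r : Fin n → ℕ) (y : ℕ → ℤ) (hy : Monotone y) (hr : ∀ i, Z 0 i = y (r i))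
    (hrn : ∀ i, r i < n)
    (hcross : ∀ d, d + 1 < n → ∃ t < B, ∃ i j, 0 < A t i j ∧
      ((r i ≤ d ∧ d < r j) ∨ (r j ≤ d ∧ d < r i))) :
    ∑ i, ((Z B i : ℝ) - y 0) ^ 2 ≤
      (1 - η / (2 * (n : ℝ) ^ 2)) * ∑ i, ((Z 0 i : ℝ) - y 0) ^ 2 := by
  classical
  set C : ℕ → ℕ → Prop := fun t d => ∃ i j, 0 < A t i j ∧
      ((r i ≤ d ∧ d < r j) ∨ (r j ≤ d ∧ d < r i)) with hC
  have inv : ∀ t d, (∀ s < t, ¬ C s d) →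
      ∀ i, (r i ≤ d → Z t i ≤ y d) ∧ (d < r i → y (d + 1) ≤ Z t i) := by
    intro t
    induction t with
    | zero =>
      intro d _ i
      rw [hr]
      exact ⟨fun h => hy h, fun h => hy h⟩
    | succ t ih =>
      intro d hd i
      have ih' := ih d (fun s hs => hd s (by omega))
      have hCt := hd t (by omega)
      obtain ⟨⟨hnn, hrow, hcol⟩, hdiag, hmin⟩ := hA t
      rw [hZ]
      constructor
      · intro hi
        have : ∑ j, A t i j * (Z t j : ℝ) ≤ (y d : ℝ) := by
          refine avg_le _ _ _ (hnn i) (hrow i) fun j hj => ?_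
          have hj' : r j ≤ d := by
            by_contra hc
            exact hCt ⟨i, j, hj, Or.inl ⟨hi, by omega⟩⟩
          exact_mod_cast (ih' j).1 hj'
        exact_mod_cast (Int.floor_le _).trans this
      · intro hi
        rw [Int.le_floor]
        refine le_avg _ _ _ (hnn i) (hrow i) fun j hj => ?_
        have hj' : d < r j := by
          by_contra hc
          exact hCt ⟨i, j, hj, Or.inr ⟨by omega, hi⟩⟩
        exact_mod_cast (ih' j).2 hj'
  have hlow : ∀ t i, y 0 ≤ Z t i := by
    intro t
    induction t with
    | zero => intro i; rw [hr]; exact hy (Nat.zero_le _)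
    | succ t ih =>
      intro i
      obtain ⟨⟨hnn, hrow, hcol⟩, hdiag, hmin⟩ := hA t
      rw [hZ, Int.le_floor]
      exact le_avg _ _ _ (hnn i) (hrow i) fun j hj => by exact_mod_cast ih j
  set g : ℕ → ℝ := fun d => (y (d + 1) : ℝ) - y d with hg
  have hg0 : ∀ d, 0 ≤ g d := fun d => by
    have : y d ≤ y (d + 1) := hy (Nat.le_succ d)
    simp only [hg, sub_nonneg]; exact_mod_cast this
  have main : ∀ t, ∑ i, ((Z t i : ℝ) - y 0) ^ 2 ≤ ∑ i, ((Z 0 i : ℝ) - y 0) ^ 2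
      - η / 2 * ∑ d ∈ Finset.range (n - 1) with (∃ s < t, C s d), g d ^ 2 := by
    intro t
    induction t with
    | zero => simp
    | succ t ih =>
      set D := (Finset.range (n - 1)).filter (fun d => (∀ s < t, ¬ C s d) ∧ C t d) with hD
      have hstep := step_decrease hη (A t) (hA t) (fun i => (Z t i : ℝ) - y 0) r D g
        (by intro d hd; simp only [hD, Finset.mem_filter] at hd; exact hd.2.2)
        (by
          intro i j
          set F := D.filter (fun d => r i ≤ d ∧ d < r j) with hF
          rcases F.eq_empty_or_nonempty with he | hne
          · rw [he]; simp only [Finset.sum_empty]; positivity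
          have hmem : ∀ d ∈ F, (∀ s < t, ¬ C s d) ∧ r i ≤ d ∧ d < r j := by
            intro d hd
            simp only [hF, hD, Finset.mem_filter] at hd
            exact ⟨hd.1.2.1, hd.2⟩
          have m1 := hmem _ (F.min'_mem hne)
          have m2 := hmem _ (F.max'_mem hne)
          have b1 : (Z t i : ℝ) ≤ y (F.min' hne) := by
            exact_mod_cast (inv t _ m1.1 i).1 m1.2.1
          have b2 : (y (F.max' hne + 1) : ℝ) ≤ Z t j := by
            exact_mod_cast (inv t _ m2.1 j).2 m2.2.2
          have hsub : F ⊆ Finset.Ico (F.min' hne) (F.max' hne + 1) := by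
            intro d hd
            rw [Finset.mem_Ico]
            exact ⟨F.min'_le d hd, Nat.lt_succ_of_le (F.le_max' d hd)⟩
          have hle : F.min' hne ≤ F.max' hne + 1 :=
            (F.min'_le_max' hne).trans (Nat.le_succ _)
          have hsum : ∑ d ∈ F, g d ≤ (y (F.max' hne + 1) : ℝ) - y (F.min' hne) := by
            rw [← Finset.sum_Ico_sub (fun d => (y d : ℝ)) hle]
            exact Finset.sum_le_sum_of_subset_of_nonneg hsub fun d _ _ => hg0 d
          have h0 : 0 ≤ ∑ d ∈ F, g d := Finset.sum_nonneg fun d _ => hg0 d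
          calc ∑ d ∈ F, g d ^ 2 ≤ (∑ d ∈ F, g d) ^ 2 :=
                Finset.sum_sq_le_sq_sum_of_nonneg fun d _ => hg0 d
            _ ≤ ((Z t j : ℝ) - Z t i) ^ 2 := pow_le_pow_left₀ h0 (by linarith) 2
            _ = _ := by ring)
      have hsplit : ∑ d ∈ Finset.range (n - 1) with (∃ s < t + 1, C s d), g d ^ 2
          = ∑ d ∈ Finset.range (n - 1) with (∃ s < t, C s d), g d ^ 2 + ∑ d ∈ D, g d ^ 2 := by
        rw [← Finset.sum_union]
        · congr 1
          ext d
          simp only [hD, Finset.mem_filter, Finset.mem_union]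
          constructor
          · rintro ⟨h1, s, hs, hc⟩
            by_cases h : ∃ s < t, C s d
            · exact Or.inl ⟨h1, h⟩
            · push Not at h
              refine Or.inr ⟨h1, h, ?_⟩
              rcases Nat.lt_succ_iff_lt_or_eq.1 hs with h' | h'
              · exact absurd hc (h s h')
              · exact h' ▸ hc
          · rintro (⟨h1, s, hs, hc⟩ | ⟨h1, h2, h3⟩)
            · exact ⟨h1, s, by omega, hc⟩
            · exact ⟨h1, t, by omega, h3⟩
        · rw [Finset.disjoint_left]
          intro d hd hd'
          simp only [hD, Finset.mem_filter] at hd hd'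
          obtain ⟨_, s, hs, hc⟩ := hd
          exact hd'.2.1 s hs hc
      have hfl : ∑ i, ((Z (t + 1) i : ℝ) - y 0) ^ 2
          ≤ ∑ i, (∑ j, A t i j * ((Z t j : ℝ) - y 0)) ^ 2 := by
        refine Finset.sum_le_sum fun i _ => ?_
        obtain ⟨⟨hnn, hrow, hcol⟩, hdiag, hmin⟩ := hA t
        have e : ∑ j, A t i j * ((Z t j : ℝ) - y 0) = ∑ j, A t i j * (Z t j : ℝ) - y 0 := by
          simp only [mul_sub, Finset.sum_sub_distrib, ← Finset.sum_mul, hrow, one_mul]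
        rw [e]
        have h1 : (y 0 : ℝ) ≤ Z (t + 1) i := by exact_mod_cast hlow (t + 1) i
        have h2 : (Z (t + 1) i : ℝ) ≤ ∑ j, A t i j * (Z t j : ℝ) := by
          rw [hZ]; exact Int.floor_le _
        exact pow_le_pow_left₀ (by linarith) (by linarith) 2
      rw [hsplit, mul_add]
      linarith
  have hB := main B
  have hall : (Finset.range (n - 1)).filter (fun d => ∃ s < B, C s d) = Finset.range (n - 1) := by
    apply Finset.filter_true_of_mem
    intro d hd
    exact hcross d (by rw [Finset.mem_range] at hd; omega)
  rw [hall] at hB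
  set G := ∑ d ∈ Finset.range (n - 1), g d ^ 2 with hG
  have hW : ∑ i, ((Z 0 i : ℝ) - y 0) ^ 2 ≤ (n : ℝ) ^ 2 * G := by
    have each : ∀ i : Fin n, ((Z 0 i : ℝ) - y 0) ^ 2 ≤ n * G := by
      intro i
      have h0 : 0 ≤ (Z 0 i : ℝ) - y 0 := by
        rw [sub_nonneg]; exact_mod_cast hlow 0 i
      have h1 : (Z 0 i : ℝ) - y 0 ≤ ∑ d ∈ Finset.range (n - 1), g d := by
        rw [Finset.sum_range_sub (fun d => (y d : ℝ)), hr]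
        have : y (r i) ≤ y (n - 1) := hy (by have := hrn i; omega)
        have : (y (r i) : ℝ) ≤ y (n - 1) := by exact_mod_cast this
        linarith
      have h2 := sq_sum_le_card_mul_sum_sq (s := Finset.range (n - 1)) (f := g)
      rw [Finset.card_range] at h2
      have h3 : ((n - 1 : ℕ) : ℝ) ≤ n := by exact_mod_cast Nat.sub_le n 1
      have hG0 : 0 ≤ G := Finset.sum_nonneg fun d _ => sq_nonneg _
      calc ((Z 0 i : ℝ) - y 0) ^ 2 ≤ (∑ d ∈ Finset.range (n - 1), g d) ^ 2 :=
            pow_le_pow_left₀ h0 h1 2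
        _ ≤ _ := h2
        _ ≤ n * G := mul_le_mul_of_nonneg_right h3 hG0
    calc ∑ i, ((Z 0 i : ℝ) - y 0) ^ 2 ≤ ∑ i : Fin n, n * G := Finset.sum_le_sum fun i _ => each i
      _ = (n : ℝ) ^ 2 * G := by simp; ring
  have hn' : (0 : ℝ) < (n : ℝ) ^ 2 := by positivity
  have : η / (2 * (n : ℝ) ^ 2) * ∑ i, ((Z 0 i : ℝ) - y 0) ^ 2 ≤ η / 2 * G := by
    calc _ ≤ η / (2 * (n : ℝ) ^ 2) * ((n : ℝ) ^ 2 * G) :=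
          mul_le_mul_of_nonneg_left hW (by positivity)
      _ = η / 2 * G := by field_simp
  linarith

lemma low_persist {n : ℕ} {η : ℝ} (A : ℕ → Matrix (Fin n) (Fin n) ℝ)
    (hA : ∀ k, GoodWeights η (A k)) (Z : ℕ → Fin n → ℤ)
    (hZ : ∀ k i, Z (k + 1) i = ⌊∑ j, A k i j * (Z k j : ℝ)⌋) (s : ℕ) (m : ℤ)
    (hm : ∀ i, m ≤ Z s i) : ∀ t i, m ≤ Z (s + t) i := by
  intro t
  induction t with
  | zero => exact hm
  | succ t ih =>
    intro i
    obtain ⟨⟨hnn, hrow, hcol⟩, hdiag, hmin⟩ := hA (s + t)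
    rw [← add_assoc, hZ, Int.le_floor]
    exact le_avg _ _ _ (hnn i) (hrow i) fun j hj => by exact_mod_cast ih j

lemma const_persist {n : ℕ} {η : ℝ} (A : ℕ → Matrix (Fin n) (Fin n) ℝ)
    (hA : ∀ k, GoodWeights η (A k)) (Z : ℕ → Fin n → ℤ)
    (hZ : ∀ k i, Z (k + 1) i = ⌊∑ j, A k i j * (Z k j : ℝ)⌋) (s : ℕ) (m : ℤ)
    (hm : ∀ i, Z s i = m) : ∀ t i, Z (s + t) i = m := by
  intro t
  induction t with
  | zero => exact hm
  | succ t ih =>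
    intro i
    obtain ⟨⟨hnn, hrow, hcol⟩, hdiag, hmin⟩ := hA (s + t)
    rw [← add_assoc, hZ]
    simp only [ih, ← Finset.sum_mul, hrow, one_mul, Int.floor_intCast]

lemma sum_drop {n : ℕ} {η : ℝ} (A : ℕ → Matrix (Fin n) (Fin n) ℝ)
    (hA : ∀ k, GoodWeights η (A k)) (Z : ℕ → Fin n → ℤ)
    (hZ : ∀ k i, Z (k + 1) i = ⌊∑ j, A k i j * (Z k j : ℝ)⌋) (t : ℕ) :
    ∑ i, (Z t i : ℝ) ≤ ∑ i, (Z 0 i : ℝ) ∧ ∑ i, (Z 0 i : ℝ) - n * t ≤ ∑ i, (Z t i : ℝ) := by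
  induction t with
  | zero => simp
  | succ t ih =>
    obtain ⟨⟨hnn, hrow, hcol⟩, hdiag, hmin⟩ := hA t
    have e : ∑ i, ∑ j, A t i j * (Z t j : ℝ) = ∑ i, (Z t i : ℝ) := by
      rw [Finset.sum_comm]
      simp only [← Finset.sum_mul, hcol, one_mul]
    have h1 : ∑ i, (Z (t + 1) i : ℝ) ≤ ∑ i, ∑ j, A t i j * (Z t j : ℝ) :=
      Finset.sum_le_sum fun i _ => by rw [hZ]; exact Int.floor_le _
    have h2 : ∑ i, (∑ j, A t i j * (Z t j : ℝ) - 1) ≤ ∑ i, (Z (t + 1) i : ℝ) :=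
      Finset.sum_le_sum fun i _ => by rw [hZ]; exact (Int.sub_one_lt_floor _).le
    rw [Finset.sum_sub_distrib, e] at h2
    rw [e] at h1
    simp only [Finset.sum_const, Finset.card_univ, Fintype.card_fin, nsmul_eq_mul, mul_one] at h2
    push_cast
    constructor <;> linarith

lemma block_step {n : ℕ} (hn : 2 ≤ n) {η : ℝ} (hη : 0 < η)
    (A : ℕ → Matrix (Fin n) (Fin n) ℝ)
    (hA : ∀ k, GoodWeights η (A k)) (B k : ℕ) (hB : BlockConnected A B k) (Z : ℕ → Fin n → ℤ)
    (hZ : ∀ k i, Z (k + 1) i = ⌊∑ j, A k i j * (Z k j : ℝ)⌋) :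
    ∃ m : ℤ, (∀ i, m ≤ Z (k * B) i) ∧ (∃ i, Z (k * B) i = m) ∧
      ∑ i, ((Z ((k + 1) * B) i : ℝ) - m) ^ 2 ≤
      (1 - η / (2 * (n : ℝ) ^ 2)) * ∑ i, ((Z (k * B) i : ℝ) - m) ^ 2 := by
  set z := Z (k * B) with hz
  set σ := Tuple.sort z with hσ
  have hmono : Monotone (z ∘ σ) := Tuple.monotone_sort z
  set y : ℕ → ℤ := fun d => z (σ ⟨min d (n - 1), by omega⟩) with hy
  set r : Fin n → ℕ := fun i => (σ.symm i : ℕ) with hr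
  have hry : ∀ i, z i = y (r i) := by
    intro i
    have : (⟨min (r i) (n - 1), by omega⟩ : Fin n) = σ.symm i := by
      apply Fin.ext
      simp only [hr]
      have := (σ.symm i).isLt
      omega
    simp only [hy, this, Equiv.apply_symm_apply]
  have hym : Monotone y := by
    intro a b hab
    apply hmono
    rw [Fin.mk_le_mk]
    omega
  have key := block_decrease (by omega) hη (fun t => A (k * B + t)) (fun t => hA _) B
    (fun t => Z (k * B + t)) (fun t i => hZ _ i) r y hym hry (fun i => (σ.symm i).isLt) (by
      intro d hd
      by_contra hcon
      push Not at hcon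
      have hpres : ∀ v, Relation.ReflTransGen
          (fun a b => ∃ t, k * B ≤ t ∧ t < (k + 1) * B ∧ 0 < A t b a)
          (σ ⟨0, by omega⟩) v → r v ≤ d := by
        intro v hv
        induction hv with
        | refl => simp [hr]
        | tail _ hab ih =>
          rename_i a b _
          obtain ⟨t, ht1, ht2, hpos⟩ := hab
          have ht : t - k * B < B := by
            rw [add_mul, one_mul] at ht2; omega
          have e : k * B + (t - k * B) = t := by omega
          have := (hcon (t - k * B) ht b a (by rw [e]; exact hpos)).2 ih
          exact this
      have := hpres (σ ⟨n - 1, by omega⟩) (hB _ _)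
      simp [hr] at this
      omega)
  refine ⟨y 0, ?_, ⟨σ ⟨min 0 (n - 1), by omega⟩, rfl⟩, ?_⟩
  · intro i
    rw [hry i]
    exact hym (Nat.zero_le _)
  · rw [add_mul, one_mul]
    exact key

lemma iterate {n : ℕ} (hn : 2 ≤ n) {η : ℝ} (hη : 0 < η) (hη1 : η ≤ 1)
    (A : ℕ → Matrix (Fin n) (Fin n) ℝ)
    (hA : ∀ k, GoodWeights η (A k)) (B : ℕ) (hB : ∀ k, BlockConnected A B k)
    (Z : ℕ → Fin n → ℤ)
    (hZ : ∀ k i, Z (k + 1) i = ⌊∑ j, A k i j * (Z k j : ℝ)⌋)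
    (D : ℝ) (m₀ : ℤ) (h0 : ∀ i, m₀ ≤ Z 0 i) (h1 : ∀ i, (Z 0 i : ℝ) - m₀ ≤ D) (k : ℕ) :
    ∃ m : ℤ, (∀ i, m ≤ Z (k * B) i) ∧
      ∑ i, ((Z (k * B) i : ℝ) - m) ^ 2 ≤
      (1 - η / (2 * (n : ℝ) ^ 2)) ^ k * (n * D ^ 2) := by
  induction k with
  | zero =>
    refine ⟨m₀, by simpa using h0, ?_⟩
    simp only [zero_mul, pow_zero, one_mul]
    calc ∑ i, ((Z 0 i : ℝ) - m₀) ^ 2 ≤ ∑ i : Fin n, D ^ 2 := by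
          refine Finset.sum_le_sum fun i _ => pow_le_pow_left₀ ?_ (h1 i) 2
          rw [sub_nonneg]; exact_mod_cast h0 i
      _ = n * D ^ 2 := by simp
  | succ k ih =>
    obtain ⟨m, hm, hV⟩ := ih
    obtain ⟨m', hm', ⟨i0, hi0⟩, hV'⟩ := block_step hn hη A hA B k (hB k) Z hZ
    refine ⟨m', ?_, hV'.trans ?_⟩
    · have := low_persist A hA Z hZ (k * B) m' hm' B
      rw [add_mul, one_mul]; exact this
    · rw [pow_succ' _ k, mul_assoc]
      have hn1 : (1 : ℝ) ≤ (n : ℝ) ^ 2 := by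
        have : (1 : ℝ) ≤ n := by exact_mod_cast (by omega : 1 ≤ n)
        nlinarith
      apply mul_le_mul_of_nonneg_left
      · refine le_trans ?_ hV
        refine Finset.sum_le_sum fun i _ => pow_le_pow_left₀ ?_ ?_ 2
        · rw [sub_nonneg]; exact_mod_cast hm' i
        · have : m ≤ m' := hi0 ▸ hm i0
          have : (m : ℝ) ≤ m' := by exact_mod_cast this
          linarith
      · rw [sub_nonneg, div_le_one (by positivity)]
        linarith

lemma core {n : ℕ} (hn : 2 ≤ n) {η : ℝ} (hη : 0 < η)
    (A : ℕ → Matrix (Fin n) (Fin n) ℝ)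
    (hA : ∀ k, GoodWeights η (A k)) (B : ℕ) (hB : ∀ k, BlockConnected A B k)
    (Z : ℕ → Fin n → ℤ)
    (hZ : ∀ k i, Z (k + 1) i = ⌊∑ j, A k i j * (Z k j : ℝ)⌋)
    (D : ℝ) (hD : 1 ≤ D) (m₀ : ℤ) (h0 : ∀ i, m₀ ≤ Z 0 i) (h1 : ∀ i, (Z 0 i : ℝ) - m₀ ≤ D) :
    ∃ (T : ℕ) (m : ℤ), (∀ k, T ≤ k → ∀ i, Z k i = m) ∧
      |(m : ℝ) - (∑ i, (Z 0 i : ℝ)) / n| ≤ 6 * ((n : ℝ) ^ 2 / η) * B * Real.log (n * D) := by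
  have hn2 : (2 : ℝ) ≤ n := by exact_mod_cast hn
  have hη1 : η ≤ 1 := by
    obtain ⟨⟨hnn, hrow, hcol⟩, hdiag, hmin⟩ := hA 0
    have i0 : Fin n := ⟨0, by omega⟩
    rw [← hrow i0]
    exact (hmin i0 i0 (hdiag i0)).trans
      (Finset.single_le_sum (f := fun j => A 0 i0 j) (fun j _ => hnn i0 j) (Finset.mem_univ i0))
  set ε := η / (2 * (n : ℝ) ^ 2) with hε
  have hε0 : 0 < ε := by positivity
  have hM : 0 < (n : ℝ) * D ^ 2 := by positivity
  set ℓ := Real.log (n * D ^ 2) with hℓ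
  have hℓ0 : 0 ≤ ℓ := Real.log_nonneg (by nlinarith)
  set K := ⌊ℓ / ε⌋₊ + 1 with hK
  have hK1 : ℓ / ε < K := by rw [hK]; push_cast; exact Nat.lt_floor_add_one _
  have hK2 : (K : ℝ) ≤ ℓ / ε + 1 := by
    rw [hK]; push_cast
    have := Nat.floor_le (div_nonneg hℓ0 hε0.le)
    linarith
  obtain ⟨m, hm, hV⟩ := iterate hn hη hη1 A hA B hB Z hZ D m₀ h0 h1 K
  have hn1 : (1 : ℝ) ≤ (n : ℝ) ^ 2 := by nlinarith
  have hε1 : ε ≤ 1 := by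
    rw [hε, div_le_one (by positivity)]; linarith
  have hlt : (1 - ε) ^ K * (n * D ^ 2) < 1 := by
    have e1 : (1 - ε) ^ K ≤ Real.exp (-(ε * K)) := by
      calc (1 - ε) ^ K ≤ (Real.exp (-ε)) ^ K :=
            pow_le_pow_left₀ (by linarith) (Real.one_sub_le_exp_neg ε) K
        _ = Real.exp (-(ε * K)) := by rw [← Real.exp_nat_mul]; congr 1; ring
    have e2 : ℓ < ε * K := by rw [div_lt_iff₀ hε0] at hK1; linarith
    calc (1 - ε) ^ K * (n * D ^ 2) ≤ Real.exp (-(ε * K)) * Real.exp ℓ := by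
          rw [hℓ, Real.exp_log hM]
          exact mul_le_mul_of_nonneg_right e1 hM.le
      _ = Real.exp (ℓ - ε * K) := by rw [← Real.exp_add]; congr 1; ring
      _ < 1 := by rw [Real.exp_lt_one_iff]; linarith
  have hcons : ∀ i, Z (K * B) i = m := by
    intro i
    have hs : ((Z (K * B) i : ℝ) - m) ^ 2 < 1 :=
      lt_of_le_of_lt ((Finset.single_le_sum (f := fun i => ((Z (K * B) i : ℝ) - m) ^ 2)
        (fun j _ => sq_nonneg _) (Finset.mem_univ i)).trans hV) hlt
    have hs' : (Z (K * B) i - m) ^ 2 < 1 := by exact_mod_cast hs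
    have := hm i
    by_contra hne
    have : 1 ≤ Z (K * B) i - m := by omega
    nlinarith
  refine ⟨K * B, m, ?_, ?_⟩
  · intro k hk i
    obtain ⟨t, rfl⟩ := Nat.exists_eq_add_of_le hk
    exact const_persist A hA Z hZ _ m hcons t i
  · obtain ⟨d1, d2⟩ := sum_drop A hA Z hZ (K * B)
    simp only [hcons, Finset.sum_const, Finset.card_univ, Fintype.card_fin, nsmul_eq_mul] at d1 d2
    set S := ∑ i, (Z 0 i : ℝ)
    have hn0 : (0 : ℝ) < n := by linarith
    have f1 : (m : ℝ) ≤ S / n := by rw [le_div_iff₀ hn0]; linarith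
    have f2 : S / n ≤ m + (K * B : ℕ) := by rw [div_le_iff₀ hn0]; linarith
    rw [abs_sub_comm, abs_of_nonneg (by linarith)]
    push_cast at f2
    set q := (n : ℝ) ^ 2 / η with hq
    have hq4 : 4 ≤ q := by rw [hq, le_div_iff₀ hη]; nlinarith
    set lg := Real.log (n * D) with hlg
    have hlg1 : 1 / 2 ≤ lg := by
      have : Real.log 2 ≤ lg := Real.log_le_log (by norm_num) (by nlinarith)
      have := Real.log_two_gt_d9
      linarith
    have hℓlg : ℓ ≤ 2 * lg := by
      rw [hℓ, hlg, ← Real.log_rpow (by positivity)]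
      apply Real.log_le_log hM
      norm_num
      nlinarith [sq_nonneg D]
    have hεq : ℓ / ε = 2 * q * ℓ := by rw [hε, hq]; field_simp
    have hKb : (K : ℝ) ≤ 6 * q * lg := by
      rw [hεq] at hK2
      nlinarith [mul_le_mul_of_nonneg_left hℓlg (by linarith : 0 ≤ q)]
    have : (K : ℝ) * B ≤ 6 * q * lg * B := mul_le_mul_of_nonneg_right hKb (Nat.cast_nonneg B)
    linarith

/-- the quantized algorithm reaches consensus on some value `x_f`, and
`|x_f - (1/n)Σ x_i(0)| ≤ (c/Q)(n²/η) B log(Qn(U-L))` for an absolute constant `c`. -/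
theorem stmt18 :
    ∃ c : ℝ, 0 < c ∧
      ∀ (n : ℕ), 2 ≤ n → ∀ (η : ℝ), 0 < η → ∀ (B : ℕ), 1 ≤ B → ∀ (Q : ℕ), 0 < Q →
        ∀ (A : ℕ → Matrix (Fin n) (Fin n) ℝ), (∀ k, GoodWeights η (A k)) →
          (∀ k, BlockConnected A B k) →
            ∀ (x : ℕ → Fin n → ℝ), (∀ i, ∃ m : ℤ, x 0 i = (m : ℝ) / Q) →
              (∀ k i, x (k + 1) i = qfloor Q ((A k).mulVec (x k) i)) →
                ∀ U L : ℝ, IsGreatest (Set.range (x 0)) U → IsLeast (Set.range (x 0)) L →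
                  L < U →
                    ∃ (T : ℕ) (xf : ℝ), (∀ k, T ≤ k → ∀ i, x k i = xf) ∧
                      |xf - avgVec (x 0)| ≤
                        c / Q * ((n : ℝ) ^ 2 / η) * B * Real.log ((Q : ℝ) * n * (U - L)) := by

  refine ⟨6, by norm_num, ?_⟩
  intro n hn η hη B _ Q hQ A hA hBC x hx0 hx U L hU hL hLU
  have hQ' : (0 : ℝ) < Q := by exact_mod_cast hQ
  have hint : ∀ k i, ∃ m : ℤ, x k i = (m : ℝ) / Q := by
    intro k i
    cases k with
    | zero => exact hx0 i
    | succ k => exact ⟨_, hx k i⟩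
  choose Z hZx using hint
  have hmul : ∀ k i, (Q : ℝ) * x k i = Z k i := by
    intro k i; rw [hZx]; field_simp
  have hZ : ∀ k i, Z (k + 1) i = ⌊∑ j, A k i j * (Z k j : ℝ)⌋ := by
    intro k i
    have h1 := hmul (k + 1) i
    rw [hx, qfloor, mul_div_cancel₀ _ hQ'.ne'] at h1
    have h2 : ∑ j, A k i j * (Z k j : ℝ) = (Q : ℝ) * (A k).mulVec (x k) i := by
      simp only [Matrix.mulVec, dotProduct, Finset.mul_sum, ← hmul]
      exact Finset.sum_congr rfl fun j _ => by ring
    rw [h2]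
    exact_mod_cast h1.symm
  obtain ⟨⟨iU, hiU⟩, hUb⟩ := hU
  obtain ⟨⟨iL, hiL⟩, hLb⟩ := hL
  have hUZ : (Q : ℝ) * U = Z 0 iU := by rw [← hiU, hmul]
  have hLZ : (Q : ℝ) * L = Z 0 iL := by rw [← hiL, hmul]
  have hlt : (Z 0 iL : ℝ) < Z 0 iU := by
    rw [← hUZ, ← hLZ]; exact mul_lt_mul_of_pos_left hLU hQ'
  have hlt' : Z 0 iL + 1 ≤ Z 0 iU := by
    have : Z 0 iL < Z 0 iU := by exact_mod_cast hlt
    omega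
  have hlt'' : (Z 0 iL : ℝ) + 1 ≤ Z 0 iU := by exact_mod_cast hlt'
  obtain ⟨T, m, hT, hbd⟩ := core hn hη A hA B hBC Z hZ (Q * (U - L))
    (by rw [mul_sub, hUZ, hLZ]; linarith) (Z 0 iL)
    (by
      intro i
      have : (Z 0 iL : ℝ) ≤ Z 0 i := by
        rw [← hLZ, ← hmul]
        exact mul_le_mul_of_nonneg_left (hLb ⟨i, rfl⟩) hQ'.le
      exact_mod_cast this)
    (by
      intro i
      have : (Z 0 i : ℝ) ≤ Z 0 iU := by
        rw [← hUZ, ← hmul]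
        exact mul_le_mul_of_nonneg_left (hUb ⟨i, rfl⟩) hQ'.le
      rw [mul_sub, hUZ, hLZ]; linarith)
  refine ⟨T, (m : ℝ) / Q, fun k hk i => by rw [hZx, hT k hk i], ?_⟩
  have e : (m : ℝ) / Q - avgVec (x 0) = ((m : ℝ) - (∑ i, (Z 0 i : ℝ)) / n) / Q := by
    simp only [avgVec, ← hmul, ← Finset.mul_sum]
    field_simp
  rw [e, abs_div, abs_of_pos hQ', div_le_iff₀ hQ']
  refine hbd.trans (le_of_eq ?_)
  rw [show (Q : ℝ) * n * (U - L) = n * (Q * (U - L)) by ring]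
  field_simp
end

section
/- Let η > 0 and B ≥ 1, and let A(k), k ≥ 0, be a sequence of n×n doubly stochastic matrices with positive diagonal entries whose positive entries are all at least η, such that for every k the directed graph with edge set E(A(kB)) ∪ E(A(kB+1)) ∪ ⋯ ∪ E(A((k+1)B−1)) is strongly connected. Let x(k+1) = A(k)x(k) for all k. Then for every i ∈ {1,…,n}, lim_{k→∞} x_i(k) = (1/n) Σ_{j=1}^n x_j(0). -/
open Matrix Finset Real Filter

lemma row_drop {n : ℕ} (A : Matrix (Fin n) (Fin n) ℝ) (hA : IsDoublyStochastic A)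
    (x : Fin n → ℝ) :
    ∑ l, ∑ j, A l j * (x j - A.mulVec x l) ^ 2 = ∑ j, x j ^ 2 - ∑ l, (A.mulVec x l) ^ 2 := by
  obtain ⟨-, hr, hc⟩ := hA
  have h : ∀ l, ∑ j, A l j * (x j - A.mulVec x l) ^ 2
      = ∑ j, A l j * x j ^ 2 - (A.mulVec x l) ^ 2 := by
    intro l
    have h1 : A.mulVec x l = ∑ j, A l j * x j := rfl
    set m := A.mulVec x l with hm
    calc ∑ j, A l j * (x j - m) ^ 2
        = ∑ j, (A l j * x j ^ 2 - 2 * m * (A l j * x j) + m ^ 2 * A l j) := by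
          refine Finset.sum_congr rfl fun j _ => by ring
      _ = ∑ j, A l j * x j ^ 2 - 2 * m * (∑ j, A l j * x j) + m ^ 2 * ∑ j, A l j := by
          rw [Finset.sum_add_distrib, Finset.sum_sub_distrib, Finset.mul_sum, Finset.mul_sum]
      _ = _ := by rw [hr, ← h1]; ring
  rw [Finset.sum_congr rfl fun l _ => h l, Finset.sum_sub_distrib, Finset.sum_comm]
  congr 1
  refine Finset.sum_congr rfl fun j _ => ?_
  rw [← Finset.sum_mul, hc, one_mul]

/-- under Assumptions 1 and 2, every `x_i(k)` converges to the average of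
the initial values. -/
theorem stmt19 {n : ℕ} (η : ℝ) (hη : 0 < η) (B : ℕ) (hB : 1 ≤ B)
    (A : ℕ → Matrix (Fin n) (Fin n) ℝ) (hA : ∀ k, GoodWeights η (A k))
    (hconn : ∀ k, BlockConnected A B k)
    (x : ℕ → Fin n → ℝ) (hx : ∀ k, x (k + 1) = (A k).mulVec (x k)) :
    ∀ i : Fin n, Filter.Tendsto (fun k => x k i) Filter.atTop (nhds (avgVec (x 0))) := by
  have hstep : ∀ t l j, 0 < A t l j → η * (x t j - x (t + 1) l) ^ 2
      ≤ ∑ j, x t j ^ 2 - ∑ j, x (t + 1) j ^ 2 := by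
    intro t l j h
    have h0 := (hA t).1.1
    rw [hx t, ← row_drop (A t) (hA t).1 (x t)]
    calc η * (x t j - (A t).mulVec (x t) l) ^ 2
        ≤ A t l j * (x t j - (A t).mulVec (x t) l) ^ 2 :=
          mul_le_mul_of_nonneg_right ((hA t).2.2 l j h) (sq_nonneg _)
      _ ≤ ∑ j, A t l j * (x t j - (A t).mulVec (x t) l) ^ 2 :=
          Finset.single_le_sum (f := fun j => A t l j * (x t j - (A t).mulVec (x t) l) ^ 2)
            (fun j _ => mul_nonneg (h0 l j) (sq_nonneg _)) (Finset.mem_univ j)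
      _ ≤ _ :=
          Finset.single_le_sum
            (f := fun l => ∑ j, A t l j * (x t j - (A t).mulVec (x t) l) ^ 2)
            (fun l _ => Finset.sum_nonneg fun j _ => mul_nonneg (h0 l j) (sq_nonneg _))
            (Finset.mem_univ l)
  intro i
  have hanti : Antitone (fun t => ∑ j, x t j ^ 2) := by
    refine antitone_nat_of_succ_le fun t => ?_
    have h1 := hstep t i i ((hA t).2.1 i)
    have : 0 ≤ η * (x t i - x (t + 1) i) ^ 2 := by positivity
    linarith
  have hlim := tendsto_atTop_ciInf hanti
    ⟨0, by rintro _ ⟨t, rfl⟩; exact Finset.sum_nonneg fun j _ => sq_nonneg _⟩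
  have hd : Tendsto (fun t => (∑ j, x t j ^ 2 - ∑ j, x (t + 1) j ^ 2) / η) atTop (nhds 0) := by
    have := (hlim.sub (hlim.comp (tendsto_add_atTop_nat 1))).div_const η
    simpa using this
  have hg : Tendsto (fun t => √((∑ j, x t j ^ 2 - ∑ j, x (t + 1) j ^ 2) / η)) atTop (nhds 0) := by
    have := (Real.continuous_sqrt.tendsto 0).comp hd
    rw [Real.sqrt_zero] at this
    exact this
  have habs : ∀ t l j, 0 < A t l j → ‖x t j - x (t + 1) l‖
      ≤ √((∑ j, x t j ^ 2 - ∑ j, x (t + 1) j ^ 2) / η) := by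
    intro t l j h
    rw [Real.norm_eq_abs]
    apply Real.abs_le_sqrt
    rw [le_div_iff₀ hη, mul_comm]
    exact hstep t l j h
  have h2 : ∀ a s, Tendsto (fun k => x (k + s) a - x k a) atTop (nhds 0) := by
    intro a s
    induction s with
    | zero => simp
    | succ s ih =>
      have h := squeeze_zero_norm (fun t => habs t a a ((hA t).2.1 a)) hg
      have := ih.sub (h.comp (tendsto_add_atTop_nat s))
      rw [sub_zero] at this
      refine this.congr fun k => ?_
      simp only [Function.comp]
      rw [← add_assoc]
      ring
  have hc : ∀ k, ∀ u v : Fin n, Relation.ReflTransGen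
      (fun a b => ∃ s : Fin (2 * B), 0 < A (k + s) b a) u v := by
    intro k u v
    refine Relation.ReflTransGen.mono ?_ u v (hconn (k / B + 1) u v)
    rintro a b ⟨t, ht1, ht2, ht⟩
    have e := Nat.div_add_mod k B
    have e2 := Nat.mod_lt k hB
    have e3 : (k / B + 1) * B = B * (k / B) + B := by ring
    have e4 : (k / B + 1 + 1) * B = B * (k / B) + 2 * B := by ring
    rw [e3] at ht1
    rw [e4] at ht2
    refine ⟨⟨t - k, by omega⟩, ?_⟩
    have : k + (t - k) = t := by omega
    simpa [this] using ht
  have h3 : ∀ u v, Tendsto (fun k => x k u - x k v) atTop (nhds 0) := by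
    intro u v
    rw [tendsto_iff_ultrafilter]
    intro U hU
    have key : ∃ R : Fin n → Fin n → Fin (2 * B) → Prop,
        ∀ a b, ∀ s : Fin (2 * B), (∀ᶠ k in (U : Filter ℕ), (0 < A (k + s) b a ↔ R a b s)) := by
      refine ⟨fun a b s => ∀ᶠ k in (U : Filter ℕ), 0 < A (k + s) b a, fun a b s => ?_⟩
      by_cases h : ∀ᶠ k in (U : Filter ℕ), 0 < A (k + s) b a
      · filter_upwards [h] with k hk
        exact ⟨fun _ => h, fun _ => hk⟩
      · have h' := Ultrafilter.eventually_not.2 h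
        filter_upwards [h'] with k hk
        exact ⟨fun q => absurd q hk, fun q => absurd q h⟩
    obtain ⟨R, hR⟩ := key
    have hall : ∀ᶠ k in (U : Filter ℕ), ∀ a b, ∀ s : Fin (2 * B), (0 < A (k + s) b a ↔ R a b s) := by
      simp only [eventually_all]
      exact hR
    obtain ⟨k, hk⟩ := hall.exists
    have hp := hc k u v
    induction hp with
    | refl => simp
    | @tail a b _ hab ih =>
      obtain ⟨s, hs⟩ := hab
      have hRs := (hk a b s).1 hs
      have hev : ∀ᶠ k in (U : Filter ℕ), 0 < A (k + s) b a :=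
        (hR a b s).mono fun k hk => hk.2 hRs
      have t1 := (h2 a s).mono_left hU
      have t2 := (h2 b (s + 1)).mono_left hU
      have t3 : Tendsto (fun k => x (k + s) a - x (k + s + 1) b) U (nhds 0) :=
        squeeze_zero_norm' (hev.mono fun k hk => habs (k + s) b a hk)
          ((hg.comp (tendsto_add_atTop_nat s)).mono_left hU)
      have := ((ih.sub t1).add t3).add t2
      simp only [sub_zero, add_zero] at this
      refine this.congr fun k => ?_
      rw [← add_assoc]
      ring
  have hsum : ∀ k, ∑ j, x k j = ∑ j, x 0 j := by
    intro k
    induction k with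
    | zero => rfl
    | succ k ih =>
      rw [← ih, hx k]
      simp only [Matrix.mulVec, dotProduct]
      rw [Finset.sum_comm]
      refine Finset.sum_congr rfl fun j _ => ?_
      rw [← Finset.sum_mul, (hA k).1.2.2, one_mul]
  have hn : (n : ℝ) ≠ 0 := by
    have := i.pos
    positivity
  have hfin : Tendsto (fun k => (∑ j, (x k i - x k j)) / n + avgVec (x 0)) atTop
      (nhds ((∑ _j : Fin n, (0 : ℝ)) / n + avgVec (x 0))) :=
    ((tendsto_finsetSum _ fun j _ => h3 i j).div_const _).add_const _
  simp only [Finset.sum_const_zero, zero_div, zero_add] at hfin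
  refine hfin.congr fun k => ?_
  rw [Finset.sum_sub_distrib, hsum k, avgVec]
  simp
  field_simp
  ring
end
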